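/- Let m, n, r be natural numbers with r ≤ m. Let A be an m×n matrix over ℤ, and let U be an m×m integer matrix and V an n×n integer matrix, each with determinant a unit of ℤ. Set S = U·A·V, and suppose that every entry of S in one of the last r rows is zero and that the rank of S over ℚ equals m−r. Let π : ℤ^m → ℤ^r be the ℤ-linear map whose matrix consists of the last r rows of U. Then: (i) π vanishes on the image of the linear map ℤ^n → ℤ^m given by A (i.e. π(A·y) = 0 for all y ∈ ℤ^n); (ii) π is surjective; and (iii) for every x ∈ ℤ^m with π(x) = 0 there exists a nonzero integer k such that k·x lies in the ℤ-span of the columns of A. Consequently π induces an isomorphism of the quotient of coker(A : ℤ^n → ℤ^m) by its torsion subgroup onto ℤ^r. -/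

import Mathlib

open Module in
/-- If the rows of a matrix over a field vanish on an injectively indexed family and its rank is
maximal subject to that, then its range is the space of all vectors vanishing on that family. -/
theorem Matrix.range_mulVecLin_eq_ker_funLeft {ι κ ρ K : Type*} [Field K] [Fintype ι] [Fintype κ]
    [Fintype ρ] (S : Matrix ι κ K) {e : ρ → ι} (he : Function.Injective e)
    (hzero : ∀ i j, S (e i) j = 0) (hrank : S.rank = Fintype.card ι - Fintype.card ρ) :
    LinearMap.range S.mulVecLin = LinearMap.ker (LinearMap.funLeft K K e) := by
  apply Submodule.eq_of_le_of_finrank_eq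
  · rintro _ ⟨y, rfl⟩
    ext i
    simp [LinearMap.funLeft_apply, Matrix.mulVec, dotProduct, hzero]
  · have hker := (LinearMap.funLeft K K e).finrank_range_add_finrank_ker
    rw [LinearMap.range_eq_top.mpr (LinearMap.funLeft_surjective_of_injective K K e he),
      finrank_top, finrank_fintype_fun_eq_card, finrank_fintype_fun_eq_card] at hker
    change S.rank = _
    omega

/-- An integer vector in the rational column span of an integer matrix has a nonzero multiple in
the integral column span. -/
theorem Matrix.exists_smul_mem_range_of_cast_mem_range {ι κ : Type*} [Fintype κ]
    (S : Matrix ι κ ℤ) (z : ι → ℤ)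
    (hz : (fun i => (z i : ℚ)) ∈ LinearMap.range (S.map (Int.cast : ℤ → ℚ)).mulVecLin) :
    ∃ k : ℤ, k ≠ 0 ∧ k • z ∈ LinearMap.range S.mulVecLin := by
  obtain ⟨w, hw⟩ := hz
  obtain ⟨b, hb⟩ := IsLocalization.exist_integer_multiples_of_finite (nonZeroDivisors ℤ) w
  choose y hy using hb
  refine ⟨b, nonZeroDivisors.coe_ne_zero b, y, ?_⟩
  ext i
  have hwi := congrFun hw i
  simp only [Matrix.mulVecLin_apply, Matrix.mulVec, dotProduct, Matrix.map_apply] at hwi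
  simp only [algebraMap_int_eq, eq_intCast, zsmul_eq_mul] at hy
  simp only [Matrix.mulVecLin_apply, Matrix.mulVec, dotProduct, Pi.smul_apply, smul_eq_mul]
  rw [← Int.cast_inj (α := ℚ)]
  push_cast
  rw [← hwi, Finset.mul_sum]
  refine Finset.sum_congr rfl fun j _ => ?_
  rw [hy j]
  ring

/-- A surjection of a module onto a torsion-free module whose kernel is the saturation of `N`
identifies the torsion-free quotient of `M ⧸ N` with its target. -/
theorem Submodule.nonempty_quotient_torsion_equiv {R M F : Type*} [CommRing R] [IsDomain R]
    [AddCommGroup M] [Module R M] [AddCommGroup F] [Module R F] [Module.IsTorsionFree R F]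
    (N : Submodule R M) (f : M →ₗ[R] F) (hN : N ≤ LinearMap.ker f) (hf : Function.Surjective f)
    (hker : ∀ x, f x = 0 → ∃ k : R, k ≠ 0 ∧ k • x ∈ N) :
    Nonempty (((M ⧸ N) ⧸ Submodule.torsion R (M ⧸ N)) ≃ₗ[R] F) := by
  have htorsion : Submodule.torsion R (M ⧸ N) = LinearMap.ker (N.liftQ f hN) := by
    ext q
    obtain ⟨x, rfl⟩ := N.mkQ_surjective q
    rw [Submodule.mem_torsion_iff, LinearMap.mem_ker, Submodule.mkQ_apply, Submodule.liftQ_apply]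
    constructor
    · rintro ⟨a, ha⟩
      have hax : (a : R) • x ∈ N := (Submodule.Quotient.mk_eq_zero N).mp ha
      have hfx := hN hax
      rw [LinearMap.mem_ker, map_smul] at hfx
      exact (smul_eq_zero.mp hfx).resolve_left (nonZeroDivisors.coe_ne_zero a)
    · intro hx
      obtain ⟨k, hk, hkx⟩ := hker x hx
      exact ⟨⟨k, mem_nonZeroDivisors_of_ne_zero hk⟩, (Submodule.Quotient.mk_eq_zero N).mpr hkx⟩
  have hsurj : Function.Surjective (N.liftQ f hN) := fun y =>
    (hf y).imp' N.mkQ fun x hx => by simpa using hx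
  exact ⟨(Submodule.quotEquivOfEq _ _ htorsion).trans
    ((N.liftQ f hN).quotKerEquivOfSurjective hsurj)⟩

/-- Smith-normal-form computation of the torsion-free quotient: if `S = U·A·V` with
`U`, `V` invertible over `ℤ`, the last `r` rows of `S` vanish, and `S` has rank
`m - r` over `ℚ`, then the map `π : ℤ^m → ℤ^r` given by the last `r` rows of `U`
kills the column span of `A`, is surjective, and its kernel is exactly the set of
vectors with a nonzero multiple in the column span of `A`; consequently `π` induces
an isomorphism of `coker(A)` modulo torsion onto `ℤ^r`. -/
theorem smith_last_rows_give_free_quotient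
    (m n r : ℕ) (hr : r ≤ m)
    (A : Matrix (Fin m) (Fin n) ℤ)
    (U : Matrix (Fin m) (Fin m) ℤ) (hU : IsUnit U.det)
    (V : Matrix (Fin n) (Fin n) ℤ) (hV : IsUnit V.det)
    (S : Matrix (Fin m) (Fin n) ℤ) (hS : S = U * A * V)
    (hzero : ∀ (i : Fin m) (j : Fin n), m - r ≤ (i : ℕ) → S i j = 0)
    (hrank : (S.map (Int.cast : ℤ → ℚ)).rank = m - r)
    (P : Matrix (Fin r) (Fin m) ℤ)
    (hP : ∀ (i : Fin r) (j : Fin m), P i j = U ⟨m - r + (i : ℕ), by omega⟩ j) :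
    (∀ y : Fin n → ℤ, P.mulVec (A.mulVec y) = 0) ∧
    Function.Surjective P.mulVecLin ∧
    (∀ x : Fin m → ℤ, P.mulVec x = 0 →
      ∃ k : ℤ, k ≠ 0 ∧ k • x ∈ LinearMap.range A.mulVecLin) ∧
    Nonempty
      ((((Fin m → ℤ) ⧸ LinearMap.range A.mulVecLin) ⧸
          Submodule.torsion ℤ ((Fin m → ℤ) ⧸ LinearMap.range A.mulVecLin))
        ≃ₗ[ℤ] (Fin r → ℤ)) := by
  let e : Fin r → Fin m := fun i => ⟨m - r + i, by omega⟩
  have he : Function.Injective e := fun i j hij => by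
    have := congrArg Fin.val hij
    simp only [e] at this
    omega
  have hPU : ∀ x i, P.mulVec x i = U.mulVec x (e i) := fun x i => by
    simp only [Matrix.mulVec, dotProduct, hP, e]
  rw [← Matrix.isUnit_iff_isUnit_det] at hU hV
  have hSzero : ∀ i j, S (e i) j = 0 := fun i j => hzero _ _ (Nat.le_add_right _ _)
  have hvanish : ∀ y : Fin n → ℤ, P.mulVec (A.mulVec y) = 0 := by
    intro y
    obtain ⟨w, rfl⟩ := Matrix.mulVec_surjective_iff_isUnit.mpr hV y
    ext i
    rw [hPU, Matrix.mulVec_mulVec, Matrix.mulVec_mulVec, ← hS]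
    simp [Matrix.mulVec, dotProduct, hSzero]
  have hsurj : Function.Surjective P.mulVecLin := by
    intro y
    obtain ⟨z, hz⟩ := LinearMap.funLeft_surjective_of_injective ℤ ℤ e he y
    obtain ⟨x, rfl⟩ := Matrix.mulVec_surjective_iff_isUnit.mpr hU z
    exact ⟨x, by ext i; rw [Matrix.mulVecLin_apply, hPU, ← hz, LinearMap.funLeft_apply]⟩
  have hker : ∀ x : Fin m → ℤ, P.mulVec x = 0 →
      ∃ k : ℤ, k ≠ 0 ∧ k • x ∈ LinearMap.range A.mulVecLin := by
    intro x hx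
    obtain ⟨k, hk, w, hw⟩ := S.exists_smul_mem_range_of_cast_mem_range (U.mulVec x) (by
      rw [Matrix.range_mulVecLin_eq_ker_funLeft _ he (by simp [hSzero]) (by simpa using hrank),
        LinearMap.mem_ker]
      ext i
      simp [LinearMap.funLeft_apply, ← hPU, hx])
    refine ⟨k, hk, V.mulVec w, Matrix.mulVec_injective_of_isUnit hU ?_⟩
    rw [Matrix.mulVec_smul, ← hw, hS]
    simp [Matrix.mulVec_mulVec, Matrix.mul_assoc]
  refine ⟨hvanish, hsurj, hker, ?_⟩
  refine Submodule.nonempty_quotient_torsion_equiv _ P.mulVecLin ?_ hsurj hker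
  rintro _ ⟨y, rfl⟩
  exact hvanish y
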